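/- arXiv:2201.04973 — 2 statements merged into one kernel-verified Lean document; each statement's English description precedes it below -/
import Mathlib

section
/- In the unknown-coins game starting from N ≥ 2 unknown coins and no excluded coins, the positions reachable in one legal weighing are exactly the following: (a) for each even number 2i with 0 < 2i < N, the position with N−2i unknown coins (the counterfeit among them) and 2i coins excluded; and (b) for each even number 2i with 0 < 2i ≤ N, the position with 2i destined coins (the counterfeit among them) and the other N−2i coins excluded. There are no other reachable positions. -/
/-!
A model of the counterfeit-coin weighing games.

There are `n` coins, indexed by `Fin n`, exactly one of which is counterfeit;
all genuine coins weigh the same, and the counterfeit is lighter or heavier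
than a genuine coin according to its `FakeType`.  Each coin carries a
`CoinStatus` recording the Observer's knowledge about it:

* `excluded`: the Observer knows the coin is genuine;
* `light`   : destined to be lighter (if this coin is the counterfeit, it is lighter);
* `heavy`   : destined to be heavier (if this coin is the counterfeit, it is heavier);
* `unknown` : the coin could be the counterfeit, either lighter or heavier.

Both players know the counterfeit coin and its type, and alternately perform
weighings: two disjoint sets of coins of equal size are put on the two pans of a
balance scale, and the outcome is determined by the truth.  After a balanced
weighing, the coins on the scale become excluded.  After an unbalanced weighing,
the coins off the scale become excluded; a coin on the lighter pan becomes
light-destined unless this contradicts its previous status (a heavy-destined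
coin on the lighter pan becomes excluded); symmetrically for the heavier pan;
excluded coins stay excluded.  A weighing is legal iff the Observer gains some
new information, i.e. some coin changes status.

`Found P` says the Observer has found the counterfeit coin (exactly one coin is
not excluded); `FoundAndIdentified P` says she has moreover identified it as
lighter or heavier.  In the game whose end condition is a goal `goal`, play
stops as soon as the goal is reached (`GMove goal`).  `NormalWin` is the
normal-play winning predicate for the player to move (the player unable to move
loses, so the player making the last legal weighing wins); `MisereWin` is the
misère-play winning predicate (the player whose weighing reveals the full
information, i.e. moves to a goal position, loses); `grundy` is the Grundy
(nim-)value: the `mex` of the Grundy values of the options, a position without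
options having Grundy value `0`.  Since every legal weighing strictly decreases
the total hidden information `info P`, defining these by recursion with fuel
`info P` gives the correct values.
-/

/-- The Observer's knowledge about one coin. -/
inductive CoinStatus : Type
  | excluded : CoinStatus
  | light    : CoinStatus
  | heavy    : CoinStatus
  | unknown  : CoinStatus
  deriving DecidableEq

/-- Whether the counterfeit coin is actually lighter or heavier than a genuine coin. -/
inductive FakeType : Type
  | light : FakeType
  | heavy : FakeType
  deriving DecidableEq

/-- The destiny status corresponding to the true type of the counterfeit coin. -/
def FakeType.destiny : FakeType → CoinStatus
  | FakeType.light => CoinStatus.light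
  | FakeType.heavy => CoinStatus.heavy

/-- A position of the game: the statuses of the coins (the Observer's knowledge)
together with the identity and the true type of the counterfeit coin (which both
players know). -/
structure Position (n : ℕ) : Type where
  status : Fin n → CoinStatus
  counterfeit : Fin n
  fakeType : FakeType

/-- Possible outcomes of a weighing. -/
inductive Outcome : Type
  | balanced | leftLighter | rightLighter
  deriving DecidableEq

/-- The truthful outcome of weighing pan `A` (left) against pan `B` (right):
it is determined by the location and the type of the counterfeit coin. -/
def outcome {n : ℕ} (P : Position n) (A B : Finset (Fin n)) : Outcome :=
  if P.counterfeit ∈ A then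
    (match P.fakeType with
      | FakeType.light => Outcome.leftLighter
      | FakeType.heavy => Outcome.rightLighter)
  else if P.counterfeit ∈ B then
    (match P.fakeType with
      | FakeType.light => Outcome.rightLighter
      | FakeType.heavy => Outcome.leftLighter)
  else Outcome.balanced

/-- New status of a coin that lay on the lighter pan of an unbalanced weighing. -/
def onLighterPan : CoinStatus → CoinStatus
  | CoinStatus.excluded => CoinStatus.excluded
  | CoinStatus.heavy => CoinStatus.excluded
  | _ => CoinStatus.light

/-- New status of a coin that lay on the heavier pan of an unbalanced weighing. -/
def onHeavierPan : CoinStatus → CoinStatus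
  | CoinStatus.excluded => CoinStatus.excluded
  | CoinStatus.light => CoinStatus.excluded
  | _ => CoinStatus.heavy

/-- The statuses after weighing `A` against `B`. -/
def updateStatus {n : ℕ} (P : Position n) (A B : Finset (Fin n)) (i : Fin n) :
    CoinStatus :=
  match outcome P A B with
  | Outcome.balanced =>
      if i ∈ A ∨ i ∈ B then CoinStatus.excluded else P.status i
  | Outcome.leftLighter =>
      if i ∈ A then onLighterPan (P.status i)
      else if i ∈ B then onHeavierPan (P.status i)
      else CoinStatus.excluded
  | Outcome.rightLighter =>
      if i ∈ B then onLighterPan (P.status i)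
      else if i ∈ A then onHeavierPan (P.status i)
      else CoinStatus.excluded

/-- The position obtained from `P` by weighing pan `A` against pan `B`. -/
def weigh {n : ℕ} (P : Position n) (A B : Finset (Fin n)) : Position n :=
  ⟨updateStatus P A B, P.counterfeit, P.fakeType⟩

/-- `Move P Q`: `Q` is obtained from `P` by one legal weighing, i.e. the two
pans are disjoint and carry equally many coins, and the Observer gains some new
information (some coin changes status). -/
def Move {n : ℕ} (P Q : Position n) : Prop :=
  ∃ A B : Finset (Fin n), Disjoint A B ∧ A.card = B.card ∧
    updateStatus P A B ≠ P.status ∧ Q = weigh P A B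

/-- The set of coins currently having status `s`. -/
def statusSet {n : ℕ} (P : Position n) (s : CoinStatus) : Finset (Fin n) :=
  Finset.univ.filter fun i => P.status i = s

/-- The set of coins not yet known to be genuine. -/
def nonExcluded {n : ℕ} (P : Position n) : Finset (Fin n) :=
  Finset.univ.filter fun i => P.status i ≠ CoinStatus.excluded

/-- The number of unknown coins. -/
def unknownCount {n : ℕ} (P : Position n) : ℕ :=
  (statusSet P CoinStatus.unknown).card

/-- The number of destined coins. -/
def destinedCount {n : ℕ} (P : Position n) : ℕ :=
  (statusSet P CoinStatus.light).card + (statusSet P CoinStatus.heavy).card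

/-- The number of coins sharing the counterfeit coin's status, counting the
counterfeit coin itself. -/
def sameDestinyCount {n : ℕ} (P : Position n) : ℕ :=
  (Finset.univ.filter fun i => P.status i = P.status P.counterfeit).card

/-- The Observer has found the counterfeit coin: exactly one coin is not excluded. -/
def Found {n : ℕ} (P : Position n) : Prop := (nonExcluded P).card = 1

/-- The Observer has found the counterfeit coin and knows whether it is lighter
or heavier. -/
def FoundAndIdentified {n : ℕ} (P : Position n) : Prop :=
  Found P ∧ P.status P.counterfeit ≠ CoinStatus.unknown

/-- Moves in the game whose end condition is `goal`: the game stops as soon as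
the Observer's goal is reached, so no further weighings happen after that. -/
def GMove {n : ℕ} (goal : Position n → Prop) (P Q : Position n) : Prop :=
  ¬ goal P ∧ Move P Q

/-- The amount of information about one coin still hidden from the Observer. -/
def statusWeight : CoinStatus → ℕ
  | CoinStatus.excluded => 0
  | CoinStatus.unknown => 2
  | _ => 1

/-- The total information still hidden from the Observer.  Every legal weighing
strictly decreases it, so it bounds the number of remaining moves. -/
def info {n : ℕ} (P : Position n) : ℕ := ∑ i, statusWeight (P.status i)

/-- Normal-play winning predicate, computed with fuel. -/
def NormalWinAux {n : ℕ} (moveRel : Position n → Position n → Prop) :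
    ℕ → Position n → Prop
  | 0, _ => False
  | k + 1, P => ∃ Q, moveRel P Q ∧ ¬ NormalWinAux moveRel k Q

/-- The player to move wins under normal play: a player who has no legal move
loses (so the player making the last legal weighing wins).  The fuel `info P`
suffices since every legal weighing strictly decreases `info`. -/
def NormalWin {n : ℕ} (moveRel : Position n → Position n → Prop)
    (P : Position n) : Prop :=
  NormalWinAux moveRel (info P) P

/-- Misère-play winning predicate, computed with fuel. -/
def MisereWinAux {n : ℕ} (moveRel : Position n → Position n → Prop)
    (goal : Position n → Prop) : ℕ → Position n → Prop
  | 0, P => goal P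
  | k + 1, P => goal P ∨ ∃ Q, moveRel P Q ∧ ¬ MisereWinAux moveRel goal k Q

/-- The player to move wins under misère play: the player whose weighing
reveals the full information to the Observer (i.e. moves to a position
satisfying `goal`) loses; equivalently, the player to move at a goal position
has already won.  A position is a P-position iff `MisereWin` fails there. -/
def MisereWin {n : ℕ} (moveRel : Position n → Position n → Prop)
    (goal : Position n → Prop) (P : Position n) : Prop :=
  MisereWinAux moveRel goal (info P) P

/-- Minimum excludant of a set of naturals. -/
noncomputable def mex (s : Set ℕ) : ℕ := sInf {k : ℕ | k ∉ s}

/-- Grundy values, computed with fuel. -/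
noncomputable def grundyAux {n : ℕ} (moveRel : Position n → Position n → Prop) :
    ℕ → Position n → ℕ
  | 0, _ => 0
  | k + 1, P => mex {g : ℕ | ∃ Q, moveRel P Q ∧ grundyAux moveRel k Q = g}

/-- The Grundy (nim-)value of a position: the `mex` of the Grundy values of the
positions reachable in one legal move; a position with no legal move has Grundy
value `0`.  The fuel `info P` suffices since every legal weighing strictly
decreases `info`. -/
noncomputable def grundy {n : ℕ} (moveRel : Position n → Position n → Prop)
    (P : Position n) : ℕ :=
  grundyAux moveRel (info P) P

/-- After a balanced weighing of unknown coins, the coins on the scale are excluded and the others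
remain unknown. -/
theorem updateStatus_of_notMem {n : ℕ} {P : Position n} {A B : Finset (Fin n)}
    (hall : ∀ i, P.status i = CoinStatus.unknown) (hc : P.counterfeit ∉ A ∪ B) (i : Fin n) :
    updateStatus P A B i = if i ∈ A ∪ B then CoinStatus.excluded else CoinStatus.unknown := by
  rw [Finset.mem_union, not_or] at hc
  simp [updateStatus, outcome, hc.1, hc.2, hall]

/-- After an unbalanced weighing of unknown coins, one pan is light-destined, the other one is
heavy-destined, and the coins off the scale are excluded. -/
theorem updateStatus_of_mem {n : ℕ} {P : Position n} {A B : Finset (Fin n)}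
    (hall : ∀ i, P.status i = CoinStatus.unknown) (hAB : Disjoint A B)
    (hc : P.counterfeit ∈ A ∪ B) :
    (∀ i, updateStatus P A B i = if i ∈ A then CoinStatus.light
      else if i ∈ B then CoinStatus.heavy else CoinStatus.excluded) ∨
    (∀ i, updateStatus P A B i = if i ∈ A then CoinStatus.heavy
      else if i ∈ B then CoinStatus.light else CoinStatus.excluded) := by
  have hd : ∀ i ∈ A, i ∉ B := fun _ => (Finset.disjoint_left.mp hAB ·)
  have hcases : outcome P A B = Outcome.leftLighter ∨ outcome P A B = Outcome.rightLighter := by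
    rcases Finset.mem_union.mp hc with h | h
    · cases hf : P.fakeType <;> simp [outcome, h, hf]
    · have h' : P.counterfeit ∉ A := fun hA => hd _ hA h
      cases hf : P.fakeType <;> simp [outcome, h, h', hf]
  rcases hcases with h | h
  · left
    intro i
    simp [updateStatus, h, hall, onLighterPan, onHeavierPan]
  · right
    intro i
    by_cases hA : i ∈ A
    · simp [updateStatus, h, hall, onHeavierPan, hA, hd i hA]
    · simp [updateStatus, h, hall, onLighterPan, hA]

/-- The position after a balanced weighing of unknown coins. -/
theorem weigh_of_notMem {n : ℕ} {P : Position n} {A B : Finset (Fin n)}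
    (hall : ∀ i, P.status i = CoinStatus.unknown) (hAB : Disjoint A B)
    (hc : P.counterfeit ∉ A ∪ B) :
    unknownCount (weigh P A B) = n - (A.card + B.card) ∧ destinedCount (weigh P A B) = 0 ∧
      (weigh P A B).status (weigh P A B).counterfeit = CoinStatus.unknown := by
  have hs := updateStatus_of_notMem hall hc
  refine ⟨?_, ?_, ?_⟩
  · have : statusSet (weigh P A B) CoinStatus.unknown = (A ∪ B)ᶜ := by
      ext i
      simp only [statusSet, weigh, hs, Finset.mem_filter, Finset.mem_univ, true_and,
        Finset.mem_compl]
      split_ifs with h <;> simp [h]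
    rw [unknownCount, this, Finset.card_compl, Fintype.card_fin, Finset.card_union_of_disjoint hAB]
  · have hne : ∀ s, s = CoinStatus.light ∨ s = CoinStatus.heavy →
        (statusSet (weigh P A B) s).card = 0 := by
      intro s hs'
      rw [Finset.card_eq_zero, statusSet, Finset.filter_eq_empty_iff]
      intro i _
      simp only [weigh, hs]
      rcases hs' with rfl | rfl <;> split_ifs <;> simp
    rw [destinedCount, hne _ (Or.inl rfl), hne _ (Or.inr rfl)]
  · simp only [weigh, hs, if_neg hc]

/-- The position after an unbalanced weighing of unknown coins. -/
theorem weigh_of_mem {n : ℕ} {P : Position n} {A B : Finset (Fin n)}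
    (hall : ∀ i, P.status i = CoinStatus.unknown) (hAB : Disjoint A B)
    (hc : P.counterfeit ∈ A ∪ B) :
    destinedCount (weigh P A B) = A.card + B.card ∧ unknownCount (weigh P A B) = 0 ∧
      ((weigh P A B).status (weigh P A B).counterfeit = CoinStatus.light ∨
        (weigh P A B).status (weigh P A B).counterfeit = CoinStatus.heavy) := by
  have hd : ∀ i ∈ A, i ∉ B := fun _ => (Finset.disjoint_left.mp hAB ·)
  have hset : ∀ (s : CoinStatus) (C : Finset (Fin n)),
      (∀ i, updateStatus P A B i = s ↔ i ∈ C) → (statusSet (weigh P A B) s).card = C.card := by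
    intro s C h
    congr 1
    ext i
    simp [statusSet, weigh, h]
  rw [destinedCount, unknownCount]
  rw [Finset.mem_union] at hc
  rcases updateStatus_of_mem hall hAB (Finset.mem_union.mpr hc) with hs | hs
  · rw [hset CoinStatus.light A (by grind), hset CoinStatus.heavy B (by grind),
      hset CoinStatus.unknown ∅ (by grind)]
    refine ⟨rfl, rfl, ?_⟩
    simp only [weigh, hs]
    grind
  · rw [hset CoinStatus.light B (by grind), hset CoinStatus.heavy A (by grind),
      hset CoinStatus.unknown ∅ (by grind)]
    refine ⟨Nat.add_comm _ _, rfl, ?_⟩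
    simp only [weigh, hs]
    grind

/-- With all coins unknown, every weighing that uses at least one coin is legal. -/
theorem updateStatus_ne_of_nonempty {n : ℕ} {P : Position n} {A B : Finset (Fin n)}
    (hall : ∀ i, P.status i = CoinStatus.unknown) (hAB : Disjoint A B) (hne : (A ∪ B).Nonempty) :
    updateStatus P A B ≠ P.status := by
  obtain ⟨j, hj⟩ := hne
  intro h
  have hju : updateStatus P A B j = CoinStatus.unknown := by rw [h, hall]
  by_cases hc : P.counterfeit ∈ A ∪ B
  · rcases updateStatus_of_mem hall hAB hc with hs | hs <;> grind
  · simp [updateStatus_of_notMem hall hc, hj] at hju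

/-- A set of `2 * i` coins, with `0 < i`, can be split into two pans giving a legal weighing of
unknown coins. -/
theorem exists_move_of_card_eq {n : ℕ} {P : Position n} {S : Finset (Fin n)} {i : ℕ}
    (hall : ∀ i, P.status i = CoinStatus.unknown) (hi : 0 < i) (hS : S.card = 2 * i) :
    ∃ A B : Finset (Fin n), Disjoint A B ∧ A ∪ B = S ∧ A.card + B.card = 2 * i ∧
      Move P (weigh P A B) := by
  obtain ⟨A, hAS, hA⟩ := Finset.exists_subset_card_eq (show i ≤ S.card by omega)
  have hB : (S \ A).card = i := by
    rw [Finset.card_sdiff_of_subset hAS]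
    omega
  have hU : A ∪ S \ A = S := Finset.union_sdiff_of_subset hAS
  refine ⟨A, S \ A, Finset.disjoint_sdiff, hU, by omega, A, S \ A, Finset.disjoint_sdiff,
    by omega, updateStatus_ne_of_nonempty hall Finset.disjoint_sdiff ?_, rfl⟩
  rw [hU, ← Finset.card_pos]
  omega

/-- In the unknown-coins game starting from `N ≥ 2` unknown
coins and no excluded coins, the positions reachable in one legal weighing are
exactly: (a) for each even number `2i` with `0 < 2i < N`, the position with
`N - 2i` unknown coins (the counterfeit among them) and `2i` coins excluded;
and (b) for each even number `2i` with `0 < 2i ≤ N`, the position with `2i`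
destined coins (the counterfeit among them) and the other `N - 2i` coins
excluded.  There are no other reachable positions. -/
theorem unknown_first_moves {n : ℕ} (P : Position n) (hN : 2 ≤ n)
    (hall : ∀ i, P.status i = CoinStatus.unknown) :
    (∀ Q, Move P Q →
      ((∃ i : ℕ, 0 < i ∧ 2 * i < n ∧ unknownCount Q = n - 2 * i ∧
          destinedCount Q = 0 ∧ Q.status Q.counterfeit = CoinStatus.unknown) ∨
       (∃ i : ℕ, 0 < i ∧ 2 * i ≤ n ∧ destinedCount Q = 2 * i ∧
          unknownCount Q = 0 ∧
          (Q.status Q.counterfeit = CoinStatus.light ∨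
            Q.status Q.counterfeit = CoinStatus.heavy)))) ∧
    (∀ i : ℕ, 0 < i → 2 * i < n →
      ∃ Q, Move P Q ∧ unknownCount Q = n - 2 * i ∧ destinedCount Q = 0 ∧
        Q.status Q.counterfeit = CoinStatus.unknown) ∧
    (∀ i : ℕ, 0 < i → 2 * i ≤ n →
      ∃ Q, Move P Q ∧ destinedCount Q = 2 * i ∧ unknownCount Q = 0 ∧
        (Q.status Q.counterfeit = CoinStatus.light ∨
          Q.status Q.counterfeit = CoinStatus.heavy)) := by
  refine ⟨?_, ?_, ?_⟩
  · rintro Q ⟨A, B, hAB, hcard, hne, rfl⟩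
    have hpos : 0 < A.card := by
      rw [Finset.card_pos, Finset.nonempty_iff_ne_empty]
      rintro rfl
      have hB : B = ∅ := by simpa using hcard.symm
      subst hB
      exact hne (funext fun i => by simp [updateStatus_of_notMem hall, hall])
    have hU := Finset.card_union_of_disjoint hAB
    by_cases hc : P.counterfeit ∈ A ∪ B
    · right
      have hle := Finset.card_le_univ (A ∪ B)
      rw [Fintype.card_fin] at hle
      obtain ⟨h1, h2, h3⟩ := weigh_of_mem hall hAB hc
      exact ⟨A.card, hpos, by omega, by omega, h2, h3⟩
    · left
      have hlt := Finset.card_lt_univ_of_notMem hc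
      rw [Fintype.card_fin] at hlt
      obtain ⟨h1, h2, h3⟩ := weigh_of_notMem hall hAB hc
      exact ⟨A.card, hpos, by omega, by omega, h2, h3⟩
  · intro i hi hin
    have hle : 2 * i ≤ (Finset.univ.erase P.counterfeit).card := by
      rw [Finset.card_erase_of_mem (Finset.mem_univ _), Finset.card_fin]
      omega
    obtain ⟨S, hSc, hS⟩ := Finset.exists_subset_card_eq hle
    obtain ⟨A, B, hAB, rfl, hcard, hmove⟩ := exists_move_of_card_eq hall hi hS
    have hc : P.counterfeit ∉ A ∪ B := fun h => Finset.notMem_erase _ _ (hSc h)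
    exact ⟨_, hmove, hcard ▸ weigh_of_notMem hall hAB hc⟩
  · intro i hi hin
    obtain ⟨S, hcS, -, hS⟩ := Finset.exists_subsuperset_card_eq
      (Finset.subset_univ {P.counterfeit}) (n := 2 * i)
      (by rw [Finset.card_singleton]; omega) (by rwa [Finset.card_fin])
    obtain ⟨A, B, hAB, rfl, hcard, hmove⟩ := exists_move_of_card_eq hall hi hS
    exact ⟨_, hmove, hcard ▸ weigh_of_mem hall hAB (Finset.singleton_subset_iff.mp hcS)⟩
end

section
/- For every N ≥ 3, in the misère-play unknown-coins games FM_N and FIM_N without an extra coin, the first player wins: weighing the counterfeit coin against one other coin is a legal weighing that unbalances, leaving exactly two non-excluded coins of opposite destinies (one light-destined on the lighter pan, one heavy-destined on the heavier pan) with all other coins excluded; from that position every legal weighing of the opponent completes the Observer's goal, so the opponent loses. -/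
/-- Excluded coins stay excluded. -/
lemma updateStatus_of_excluded {n : ℕ} {P : Position n} {i : Fin n}
    (h : P.status i = CoinStatus.excluded) (A B : Finset (Fin n)) :
    updateStatus P A B i = CoinStatus.excluded := by
  unfold updateStatus
  split <;> simp [h, onLighterPan, onHeavierPan]

/-- A coin that is not unknown either keeps its status or becomes excluded. -/
lemma updateStatus_eq_or_excluded {n : ℕ} {P : Position n} {i : Fin n}
    (h : P.status i ≠ CoinStatus.unknown) (A B : Finset (Fin n)) :
    updateStatus P A B i = P.status i ∨ updateStatus P A B i = CoinStatus.excluded := by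
  unfold updateStatus
  cases hs : P.status i <;> split <;> split_ifs <;>
    simp_all [onLighterPan, onHeavierPan]

/-- Once destined, the counterfeit coin keeps its true destiny. -/
lemma updateStatus_counterfeit {n : ℕ} {P : Position n} {A B : Finset (Fin n)}
    (hAB : Disjoint A B) (h : P.status P.counterfeit = P.fakeType.destiny) :
    updateStatus P A B P.counterfeit = P.fakeType.destiny := by
  have hd : P.counterfeit ∈ A → P.counterfeit ∉ B := fun hA => Finset.disjoint_left.mp hAB hA
  unfold updateStatus outcome
  cases hf : P.fakeType <;> by_cases hA : P.counterfeit ∈ A <;>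
    by_cases hB : P.counterfeit ∈ B <;>
    simp_all [FakeType.destiny, onLighterPan, onHeavierPan]

lemma FakeType.destiny_ne_excluded (t : FakeType) : t.destiny ≠ CoinStatus.excluded := by
  cases t <;> simp [FakeType.destiny]

lemma FakeType.destiny_ne_unknown (t : FakeType) : t.destiny ≠ CoinStatus.unknown := by
  cases t <;> simp [FakeType.destiny]

/-- If only the truly destined counterfeit and one other destined coin are left, then every
legal weighing finds and identifies the counterfeit. -/
lemma Move.foundAndIdentified_of_two {n : ℕ} {Q R : Position n} {j : Fin n}
    (hc : Q.status Q.counterfeit = Q.fakeType.destiny)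
    (hj : Q.status j ≠ CoinStatus.unknown)
    (hother : ∀ i, i ≠ Q.counterfeit → i ≠ j → Q.status i = CoinStatus.excluded)
    (hR : Move Q R) : FoundAndIdentified R := by
  obtain ⟨A, B, hAB, -, hne, rfl⟩ := hR
  have hc' := updateStatus_counterfeit hAB hc
  have hexcl : ∀ i, i ≠ Q.counterfeit → updateStatus Q A B i = CoinStatus.excluded := by
    intro i hi
    by_cases hij : i = j
    · subst hij
      refine (updateStatus_eq_or_excluded hj A B).resolve_left fun hsame => hne ?_
      funext k
      by_cases hkc : k = Q.counterfeit
      · rw [hkc, hc', hc]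
      by_cases hki : k = i
      · rw [hki, hsame]
      rw [updateStatus_of_excluded (hother k hkc hki), hother k hkc hki]
    · exact updateStatus_of_excluded (hother i hi hij) A B
  have hset : nonExcluded (weigh Q A B) = {Q.counterfeit} := by
    ext i
    simp only [nonExcluded, Finset.mem_filter, Finset.mem_univ, true_and, Finset.mem_singleton]
    change updateStatus Q A B i ≠ _ ↔ _
    refine ⟨fun h => by_contra fun hi => h (hexcl i hi), ?_⟩
    rintro rfl
    exact hc' ▸ Q.fakeType.destiny_ne_excluded
  refine ⟨by rw [Found, hset, Finset.card_singleton], ?_⟩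
  change updateStatus Q A B Q.counterfeit ≠ _
  exact hc' ▸ Q.fakeType.destiny_ne_unknown

lemma MisereWinAux.of_goal {n : ℕ} {moveRel : Position n → Position n → Prop}
    {goal : Position n → Prop} {P : Position n} (h : goal P) (k : ℕ) :
    MisereWinAux moveRel goal k P := by
  cases k with
  | zero => exact h
  | succ k => exact Or.inl h

/-- Moving to a non-goal position all of whose options are goal positions wins. -/
lemma MisereWin.of_forced {n : ℕ} {moveRel : Position n → Position n → Prop}
    {goal : Position n → Prop} {P Q : Position n} (hinfo : 2 ≤ info P)
    (hPQ : moveRel P Q) (hQ : ¬ goal Q) (hR : ∀ R, moveRel Q R → goal R) :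
    MisereWin moveRel goal P := by
  obtain ⟨k, hk⟩ := Nat.exists_eq_add_of_le' hinfo
  rw [MisereWin, hk]
  refine Or.inr ⟨Q, hPQ, ?_⟩
  rintro (h | ⟨R, hQR, h⟩)
  · exact hQ h
  · exact h (.of_goal (hR R hQR) k)

lemma outcome_counterfeit_ne_balanced {n : ℕ} (P : Position n) (j : Fin n) :
    outcome P {P.counterfeit} {j} ≠ Outcome.balanced := by
  cases hf : P.fakeType <;> simp [outcome, hf]

section FirstWeighing

variable {n : ℕ} {P : Position n} {j : Fin n}

lemma weigh_counterfeit_status_self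
    (hc : P.status P.counterfeit = CoinStatus.unknown) (hj : j ≠ P.counterfeit) :
    (weigh P {P.counterfeit} {j}).status P.counterfeit = P.fakeType.destiny := by
  cases hf : P.fakeType <;>
    simp [weigh, updateStatus, outcome, hf, hc, hj.symm, onLighterPan, onHeavierPan,
      FakeType.destiny]

lemma weigh_counterfeit_status_other
    (hs : P.status j = CoinStatus.unknown) (hj : j ≠ P.counterfeit) :
    (weigh P {P.counterfeit} {j}).status j =
      match P.fakeType with
      | FakeType.light => CoinStatus.heavy
      | FakeType.heavy => CoinStatus.light := by
  cases hf : P.fakeType <;>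
    simp [weigh, updateStatus, outcome, hf, hs, hj, onLighterPan, onHeavierPan]

lemma weigh_counterfeit_status_of_ne {i : Fin n} (hi : i ≠ P.counterfeit) (hij : i ≠ j) :
    (weigh P {P.counterfeit} {j}).status i = CoinStatus.excluded := by
  cases hf : P.fakeType <;> simp [weigh, updateStatus, outcome, hf, hi, hij]

lemma nonExcluded_weigh_counterfeit (hall : ∀ i, P.status i = CoinStatus.unknown)
    (hj : j ≠ P.counterfeit) :
    nonExcluded (weigh P {P.counterfeit} {j}) = {P.counterfeit, j} := by
  ext i
  simp only [nonExcluded, Finset.mem_filter, Finset.mem_univ, true_and, Finset.mem_insert,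
    Finset.mem_singleton]
  constructor
  · intro h
    by_contra! hi
    exact h (weigh_counterfeit_status_of_ne hi.1 hi.2)
  · rintro (rfl | rfl)
    · rw [weigh_counterfeit_status_self (hall _) hj]
      exact P.fakeType.destiny_ne_excluded
    · rw [weigh_counterfeit_status_other (hall _) hj]
      cases P.fakeType <;> simp

lemma not_found_weigh_counterfeit (hall : ∀ i, P.status i = CoinStatus.unknown)
    (hj : j ≠ P.counterfeit) : ¬ Found (weigh P {P.counterfeit} {j}) := by
  rw [Found, nonExcluded_weigh_counterfeit hall hj, Finset.card_pair hj.symm]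
  decide

lemma move_weigh_counterfeit (hall : ∀ i, P.status i = CoinStatus.unknown)
    (hj : j ≠ P.counterfeit) : Move P (weigh P {P.counterfeit} {j}) := by
  refine ⟨{P.counterfeit}, {j}, by simpa using hj.symm, rfl, fun h => ?_, rfl⟩
  have hs : updateStatus P {P.counterfeit} {j} P.counterfeit = P.fakeType.destiny :=
    weigh_counterfeit_status_self (hall _) hj
  rw [h, hall] at hs
  exact P.fakeType.destiny_ne_unknown hs.symm

lemma Move.foundAndIdentified_of_weigh_counterfeit
    (hall : ∀ i, P.status i = CoinStatus.unknown) (hj : j ≠ P.counterfeit) {R : Position n}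
    (hR : Move (weigh P {P.counterfeit} {j}) R) : FoundAndIdentified R := by
  refine hR.foundAndIdentified_of_two (j := j) (weigh_counterfeit_status_self (hall _) hj) ?_
    fun i hi hij => weigh_counterfeit_status_of_ne hi hij
  rw [weigh_counterfeit_status_other (hall _) hj]
  cases P.fakeType <;> simp

end FirstWeighing

lemma not_found_of_forall_unknown {n : ℕ} {P : Position n} (hn : n ≠ 1)
    (hall : ∀ i, P.status i = CoinStatus.unknown) : ¬ Found P := by
  simpa [Found, nonExcluded, hall] using hn

lemma info_of_forall_unknown {n : ℕ} {P : Position n}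
    (hall : ∀ i, P.status i = CoinStatus.unknown) : info P = n * 2 := by
  simp [info, hall, statusWeight]

/-- For every `N ≥ 3`, in the misère-play unknown-coins
games `FM_N` and `FIM_N` without an extra coin, the first player wins: weighing
the counterfeit coin against one other coin is a legal weighing that
unbalances, leaving exactly two non-excluded coins of opposite destinies (one
light-destined, one heavy-destined) with all other coins excluded; from that
position every legal weighing of the opponent completes the Observer's goal,
so the opponent loses. -/
theorem unknown_misere_win {n : ℕ} (P : Position n) (hN : 3 ≤ n)
    (hall : ∀ i, P.status i = CoinStatus.unknown) :
    (∀ j : Fin n, j ≠ P.counterfeit →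
      outcome P {P.counterfeit} {j} ≠ Outcome.balanced ∧
      GMove Found P (weigh P {P.counterfeit} {j}) ∧
      GMove FoundAndIdentified P (weigh P {P.counterfeit} {j}) ∧
      nonExcluded (weigh P {P.counterfeit} {j}) = {P.counterfeit, j} ∧
      (((weigh P {P.counterfeit} {j}).status P.counterfeit = CoinStatus.light ∧
          (weigh P {P.counterfeit} {j}).status j = CoinStatus.heavy) ∨
       ((weigh P {P.counterfeit} {j}).status P.counterfeit = CoinStatus.heavy ∧
          (weigh P {P.counterfeit} {j}).status j = CoinStatus.light)) ∧
      (∀ R, GMove Found (weigh P {P.counterfeit} {j}) R → Found R) ∧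
      (∀ R, GMove FoundAndIdentified (weigh P {P.counterfeit} {j}) R →
        FoundAndIdentified R)) ∧
    MisereWin (GMove Found) Found P ∧
    MisereWin (GMove FoundAndIdentified) FoundAndIdentified P := by
  have hP : ¬ Found P := not_found_of_forall_unknown (by omega) hall
  have hinfo : 2 ≤ info P := by rw [info_of_forall_unknown hall]; omega
  have : Nontrivial (Fin n) := Fin.nontrivial_iff_two_le.mpr (by omega)
  obtain ⟨j₀, hj₀⟩ := exists_ne P.counterfeit
  refine ⟨fun j hj => ⟨outcome_counterfeit_ne_balanced P j,
    ⟨hP, move_weigh_counterfeit hall hj⟩, ⟨fun h => hP h.1, move_weigh_counterfeit hall hj⟩,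
    nonExcluded_weigh_counterfeit hall hj, ?_,
    fun R hR => (hR.2.foundAndIdentified_of_weigh_counterfeit hall hj).1,
    fun R hR => hR.2.foundAndIdentified_of_weigh_counterfeit hall hj⟩, ?_, ?_⟩
  · rw [weigh_counterfeit_status_self (hall _) hj, weigh_counterfeit_status_other (hall _) hj]
    cases P.fakeType <;> simp [FakeType.destiny]
  · exact .of_forced hinfo ⟨hP, move_weigh_counterfeit hall hj₀⟩
      (not_found_weigh_counterfeit hall hj₀)
      fun R hR => (hR.2.foundAndIdentified_of_weigh_counterfeit hall hj₀).1
  · exact .of_forced hinfo ⟨fun h => hP h.1, move_weigh_counterfeit hall hj₀⟩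
      (fun h => not_found_weigh_counterfeit hall hj₀ h.1)
      fun R hR => hR.2.foundAndIdentified_of_weigh_counterfeit hall hj₀
end
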